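/- Let F be a field, z ≥ 1, and let λ₁⁽⁰⁾,…,λ₁⁽ᶻ⁻¹⁾, λ₂⁽⁰⁾,…,λ₂⁽ᶻ⁻¹⁾ (corresponding to λ_{6i+1}, λ_{6i+2} for 0 ≤ i ≤ z−1) be 2z pairwise distinct elements, and let γ₁⁽ⁱ⁾, γ₂⁽ⁱ⁾ ∈ F satisfy γ₁⁽ⁱ⁾ ≠ γ₂⁽ⁱ⁾ for all i. Define the 2^z·z × 2^z·z matrix Q̄ with blocks D̄_{2i}, D̄_{2i+1} (each 2^z·z × 2^{z−1}) whose length-z column-vector entries are: D̄_{2i}(a,b) = L'(λ₁⁽ⁱ⁾) if a = a(i,0,b), γ₁⁽ⁱ⁾·L'(λ₁⁽ⁱ⁾) if a = a(i,1,b), and 0 otherwise; D̄_{2i+1}(a,b) = L'(λ₂⁽ⁱ⁾) if a = a(i,0,b), γ₂⁽ⁱ⁾·L'(λ₂⁽ⁱ⁾) if a = a(i,1,b), and 0 otherwise; where L'(λ) = (1, λ, …, λ^{z−1})ᵀ and a(i,c,b) denotes the integer in {0,…,2^z−1} obtained by inserting bit c at position i of the (z−1)-bit expansion of b. Then det(Q̄)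 = c · ∏_{0≤i<j≤z−1} ((λ₁⁽ⁱ⁾−λ₁⁽ʲ⁾)(λ₂⁽ⁱ⁾−λ₁⁽ʲ⁾)(λ₁⁽ⁱ⁾−λ₂⁽ʲ⁾)(λ₂⁽ⁱ⁾−λ₂⁽ʲ⁾))^{2^{z−2}} · ∏_{i=0}^{z−1}(γ₁⁽ⁱ⁾−γ₂⁽ⁱ⁾)^{2^{z−1}} for some constant c ∈ {1, −1}; in particular Q̄ is invertible. -/

import Mathlib

open Matrix

/-- The tensor product of a finite family of square matrices. -/
def Matrix.piKronecker {ι κ R : Type*} [Fintype ι] [CommRing R] (A : ι → Matrix κ κ R) :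
    Matrix (ι → κ) (ι → κ) R :=
  fun a x => ∏ i, A i (a i) (x i)

section PiKronecker

variable {ι κ R : Type*} [Fintype ι] [CommRing R]

theorem Matrix.piKronecker_mul [DecidableEq ι] [Fintype κ] (A B : ι → Matrix κ κ R) :
    piKronecker A * piKronecker B = piKronecker fun i => A i * B i := by
  ext a x
  simp only [piKronecker, Matrix.mul_apply, ← Finset.prod_mul_distrib]
  exact (Fintype.prod_sum fun i k => A i (a i) k * B i k (x i)).symm

theorem Matrix.piKronecker_one [DecidableEq κ] :
    piKronecker (fun _ : ι => (1 : Matrix κ κ R)) = 1 := by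
  ext a x
  simp only [piKronecker, Matrix.one_apply, Finset.prod_ite_zero, funext_iff]
  simp

theorem Matrix.isUnit_det_piKronecker [DecidableEq ι] [Fintype κ] [DecidableEq κ]
    (A : ι → Matrix κ κ R) (hA : ∀ i, IsUnit (A i).det) :
    IsUnit (piKronecker A).det := by
  refine (Matrix.isUnit_iff_isUnit_det _).mp
    (IsUnit.of_mul_eq_one (piKronecker fun i => (A i)⁻¹) ?_)
  simp only [piKronecker_mul, Matrix.mul_nonsing_inv _ (hA _), piKronecker_one]

theorem Matrix.piKronecker_update_one_apply [DecidableEq ι] [DecidableEq κ] (i : ι) (A : Matrix κ κ R)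
    (a x : ι → κ) :
    piKronecker (Function.update (fun _ => 1) i A) a x =
      if ∀ j, j ≠ i → a j = x j then A (a i) (x i) else 0 := by
  rw [piKronecker, ← Finset.mul_prod_erase _ _ (Finset.mem_univ i), Function.update_self]
  rw [Finset.prod_congr rfl (g := fun j => if a j = x j then (1 : R) else 0) fun j hj => by
    rw [Function.update_of_ne (Finset.ne_of_mem_erase hj), Matrix.one_apply]]
  simp [Finset.prod_ite_zero]

theorem Matrix.det_piKronecker_update_one [DecidableEq ι] [Fintype κ] [DecidableEq κ]
    (i : ι) (A : Matrix κ κ R) :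
    (piKronecker (Function.update (fun _ => 1) i A)).det =
      A.det ^ (Fintype.card κ ^ (Fintype.card ι - 1)) := by
  have h : piKronecker (Function.update (fun _ => 1) i A) =
      (blockDiagonal fun _ : {j // j ≠ i} → κ => A).submatrix
        (Equiv.funSplitAt i κ) (Equiv.funSplitAt i κ) := by
    ext a x
    simp [piKronecker_update_one_apply, blockDiagonal_apply, funext_iff]
  rw [h, det_submatrix_equiv_self, det_blockDiagonal]
  simp [Fintype.card_subtype_compl]

theorem Matrix.piKronecker_update_mul_update [DecidableEq ι] [Fintype κ] [DecidableEq κ]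
    (i : ι) (A : ι → Matrix κ κ R) :
    piKronecker (Function.update (fun _ => 1) i (A i)) * piKronecker (Function.update A i 1) =
      piKronecker A := by
  rw [piKronecker_mul]
  congr 1
  ext1 j
  rcases eq_or_ne j i with rfl | h
  · simp
  · simp [h]

/-- If the block column `i` of a matrix acts as `A i` on the `i`-th tensor factor and is the
identity elsewhere, scaled by powers of `v i`, its determinant splits into the determinants of the
`A i` and Vandermonde determinants. -/
theorem Matrix.det_sitewise_vandermonde [Fintype κ] [DecidableEq κ] {z : ℕ}
    (A : Fin z → Matrix κ κ R)
    (hA : ∀ i, IsUnit (A i).det) (v : κ → Fin z → R) :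
    (of fun (r c : (Fin z → κ) × Fin z) =>
      piKronecker (Function.update (fun _ => 1) c.2 (A c.2)) r.1 c.1 *
        v (c.1 c.2) c.2 ^ (r.2 : ℕ)).det =
      (∏ i, (A i).det ^ (Fintype.card κ ^ (z - 1))) *
        ∏ x : Fin z → κ, (vandermonde fun i => v (x i) i).det := by
  set M := of fun (r c : (Fin z → κ) × Fin z) =>
      piKronecker (Function.update (fun _ => 1) c.2 (A c.2)) r.1 c.1 *
        v (c.1 c.2) c.2 ^ (r.2 : ℕ) with hM
  let H : Fin z → Matrix (Fin z → κ) (Fin z → κ) R :=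
    fun i => piKronecker (Function.update A i 1)
  have hH (i : Fin z) : IsUnit (H i).det := by
    refine isUnit_det_piKronecker _ fun j => ?_
    rcases eq_or_ne j i with rfl | h
    · simp
    · simpa [h] using hA j
  have hH_apply (i : Fin z) (y x : Fin z → κ) (h : y i ≠ x i) : H i y x = 0 :=
    Finset.prod_eq_zero (Finset.mem_univ i) (by simp [h])
  let V : Matrix ((Fin z → κ) × Fin z) ((Fin z → κ) × Fin z) R :=
    (blockDiagonal fun x : Fin z → κ => (vandermonde fun i => v (x i) i)ᵀ).submatrix
      (Equiv.prodComm _ _) (Equiv.prodComm _ _)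
  have key : M * blockDiagonal H =
      kroneckerMap (· * ·) (piKronecker A) (1 : Matrix (Fin z) (Fin z) R) * V := by
    ext ⟨a, t⟩ ⟨x, i⟩
    have hl : (M * blockDiagonal H) (a, t) (x, i) = piKronecker A a x * v (x i) i ^ (t : ℕ) := by
      rw [Matrix.mul_apply, Fintype.sum_prod_type_right, Fintype.sum_eq_single i]
      · rw [← piKronecker_update_mul_update i A, Matrix.mul_apply, Finset.sum_mul]
        refine Finset.sum_congr rfl fun y _ => ?_
        rw [blockDiagonal_apply_eq]
        by_cases h : y i = x i
        · simp only [hM, of_apply, h, H]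
          ring
        · have h0 := hH_apply i y x h
          simp only [H] at h0 ⊢
          simp [h0]
      · intro j hj
        simp [blockDiagonal_apply, hj]
    rw [hl, Matrix.mul_apply, Fintype.sum_prod_type, Fintype.sum_eq_single x]
    · simp [V, Matrix.one_apply, vandermonde_apply]
    · intro y hy
      simp [V, blockDiagonal_apply, hy]
  have hdet := congrArg Matrix.det key
  rw [det_mul, det_mul, det_blockDiagonal, det_kronecker, det_submatrix_equiv_self,
    det_blockDiagonal] at hdet
  have hpow : (piKronecker A).det ^ z =
      (∏ i, (A i).det ^ (Fintype.card κ ^ (z - 1))) * ∏ i, (H i).det := by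
    rw [← Finset.prod_mul_distrib]
    have (i : Fin z) : (A i).det ^ (Fintype.card κ ^ (z - 1)) * (H i).det =
        (piKronecker A).det := by
      rw [← piKronecker_update_mul_update i A, det_mul, det_piKronecker_update_one,
        Fintype.card_fin]
    simp [this]
  have hunit : IsUnit (∏ i, (H i).det) := by
    simpa [IsUnit.prod_iff] using hH
  refine hunit.mul_right_cancel ?_
  simp only [det_transpose, det_one, one_pow, mul_one, Fintype.card_fin] at hdet
  rw [hdet, hpow]
  ring

end PiKronecker

theorem Fintype.prod_pi_eval_pair {ι κ R : Type*} [Fintype ι] [DecidableEq ι] [Fintype κ]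
    [CommMonoid R] {i j : ι} (hij : i ≠ j) (f : κ → κ → R) :
    ∏ x : ι → κ, f (x i) (x j) = (∏ b, ∏ c, f b c) ^ (Fintype.card κ ^ (Fintype.card ι - 2)) := by
  classical
  rw [← (Equiv.funSplitAt i κ).symm.prod_comp, Fintype.prod_prod_type, ← Finset.prod_pow]
  refine Finset.prod_congr rfl fun b _ => ?_
  rw [← (Equiv.funSplitAt (⟨j, hij.symm⟩ : {k // k ≠ i}) κ).symm.prod_comp,
    Fintype.prod_prod_type, ← Finset.prod_pow]
  refine Finset.prod_congr rfl fun c _ => ?_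
  simp [hij.symm, Fintype.card_subtype_compl, Nat.sub_sub]

theorem Nat.testBit_add_two_pow {y i : ℕ} (h : y.testBit i = false) (j : ℕ) :
    (y + 2 ^ i).testBit j = if j = i then true else y.testBit j := by
  have hr : y % 2 ^ i < 2 ^ i := Nat.mod_lt _ (by positivity)
  have hy : y = 2 ^ i * (y / 2 ^ i) + y % 2 ^ i := (Nat.div_add_mod _ _).symm
  have hq : y / 2 ^ i % 2 = 0 := by simpa [Nat.testBit_eq_decide_div_mod_eq] using h
  have hy' : y + 2 ^ i = 2 ^ i * (y / 2 ^ i + 1) + y % 2 ^ i := by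
    conv_lhs => rw [hy]
    ring
  rw [hy', Nat.testBit_two_pow_mul_add _ hr]
  conv_rhs => rw [hy, Nat.testBit_two_pow_mul_add _ hr]
  rcases lt_trichotomy j i with hj | rfl | hj
  · simp [hj, hj.ne]
  · simp only [lt_irrefl, Nat.sub_self, Nat.testBit_zero, if_true, if_false]
    simp
    omega
  · obtain ⟨k, rfl⟩ := Nat.exists_eq_add_of_lt hj
    have hk : i + k + 1 - i = k + 1 := by omega
    have hd : (y / 2 ^ i + 1) / 2 = y / 2 ^ i / 2 := by omega
    simp [hk, Nat.testBit_succ, hd, show ¬ i + k + 1 < i by omega, show i + k + 1 ≠ i by omega]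

theorem Nat.testBit_sub_ite_two_pow (x i j : ℕ) :
    (x - if x.testBit i then 2 ^ i else 0).testBit j =
      if j = i then false else x.testBit j := by
  cases h : x.testBit i with
  | false =>
    rcases eq_or_ne j i with rfl | hj
    · simp [h]
    · simp [hj]
  | true =>
    obtain ⟨y, rfl⟩ := Nat.exists_eq_add_of_le' (Nat.ge_two_pow_of_testBit h)
    have hy : y.testBit i = false := by
      rw [add_comm, Nat.testBit_two_pow_add_eq] at h
      simpa using h
    rw [Nat.testBit_add_two_pow hy]
    rcases eq_or_ne j i with rfl | hj
    · simp [hy]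
    · simp [hj]

/-- The binary expansion of a number below `2 ^ z`. -/
noncomputable def Fin.testBitEquiv (z : ℕ) : Fin (2 ^ z) ≃ (Fin z → Bool) :=
  Equiv.ofBijective (fun x i => (x : ℕ).testBit i) <| by
    refine (Fintype.bijective_iff_injective_and_card _).mpr ⟨fun x y h => ?_, by simp⟩
    refine Fin.ext (Nat.eq_of_testBit_eq fun i => ?_)
    by_cases hi : i < z
    · exact congrFun h ⟨i, hi⟩
    · have hz : 2 ^ z ≤ 2 ^ i := Nat.pow_le_pow_right two_pos (not_lt.mp hi)
      rw [Nat.testBit_lt_two_pow (x.2.trans_le hz), Nat.testBit_lt_two_pow (y.2.trans_le hz)]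

theorem Fin.testBitEquiv_apply {z : ℕ} (x : Fin (2 ^ z)) (i : Fin z) :
    Fin.testBitEquiv z x i = (x : ℕ).testBit i := rfl

theorem Fin.val_eq_iff_testBitEquiv {z : ℕ} (a : Fin (2 ^ z)) {n : ℕ} (hn : n < 2 ^ z) :
    (a : ℕ) = n ↔ ∀ j : Fin z, Fin.testBitEquiv z a j = n.testBit j := by
  rw [show ((a : ℕ) = n) ↔ a = ⟨n, hn⟩ from (Fin.ext_iff (b := ⟨n, hn⟩)).symm,
    ← (Fin.testBitEquiv z).injective.eq_iff, funext_iff]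
  rfl

theorem Fin.val_eq_clearBit_iff {z : ℕ} (a x : Fin (2 ^ z)) (i : Fin z) :
    (a : ℕ) = x - (if (x : ℕ).testBit i then 2 ^ (i : ℕ) else 0) ↔
      Fin.testBitEquiv z a i = false ∧
        ∀ j, j ≠ i → Fin.testBitEquiv z a j = Fin.testBitEquiv z x j := by
  rw [Fin.val_eq_iff_testBitEquiv a ((Nat.sub_le _ _).trans_lt x.2)]
  simp only [Nat.testBit_sub_ite_two_pow, Fin.testBitEquiv_apply, Fin.val_inj]
  grind

theorem Fin.val_eq_setBit_iff {z : ℕ} (a x : Fin (2 ^ z)) (i : Fin z) :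
    (a : ℕ) = x - (if (x : ℕ).testBit i then 2 ^ (i : ℕ) else 0) + 2 ^ (i : ℕ) ↔
      Fin.testBitEquiv z a i = true ∧
        ∀ j, j ≠ i → Fin.testBitEquiv z a j = Fin.testBitEquiv z x j := by
  set y := (x : ℕ) - (if (x : ℕ).testBit i then 2 ^ (i : ℕ) else 0) with hy
  have hbit (j : ℕ) : (y + 2 ^ (i : ℕ)).testBit j =
      if j = i then true else (x : ℕ).testBit j := by
    rw [Nat.testBit_add_two_pow (by simp [hy, Nat.testBit_sub_ite_two_pow]), hy,
      Nat.testBit_sub_ite_two_pow]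
    split_ifs <;> rfl
  have hlt : y + 2 ^ (i : ℕ) < 2 ^ z := by
    refine Nat.lt_pow_two_of_testBit _ fun j hj => ?_
    rw [hbit, if_neg (by omega)]
    exact Nat.testBit_lt_two_pow (x.2.trans_le (Nat.pow_le_pow_right two_pos hj))
  rw [Fin.val_eq_iff_testBitEquiv a hlt]
  simp only [hbit, Fin.testBitEquiv_apply, Fin.val_inj]
  grind

theorem Matrix.prod_det_vandermonde_bool {R : Type*} [CommRing R] {z : ℕ}
    (v : Bool → Fin z → R) :
    ∏ x : Fin z → Bool, (vandermonde fun i => v (x i) i).det =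
      ∏ i : Fin z, ∏ j : Fin z, if (i : ℕ) < (j : ℕ) then
        ((v false i - v false j) * (v true i - v false j) *
          (v false i - v true j) * (v true i - v true j)) ^ (2 ^ (z - 2)) else 1 := by
  simp only [det_vandermonde]
  rw [Finset.prod_comm]
  refine Finset.prod_congr rfl fun i _ => ?_
  rw [Finset.prod_comm, ← Finset.prod_filter]
  refine Finset.prod_congr (by ext j; simp) fun j hj => ?_
  have hij : i ≠ j := by
    rintro rfl
    simp at hj
  rw [Fintype.prod_pi_eval_pair hij fun b c => v c j - v b i]
  simp only [Fintype.prod_bool, Fintype.card_bool, Fintype.card_fin]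
  congr 1
  ring


theorem stmt_11 (F : Type*) [Field F] (z : ℕ) (hz : 1 ≤ z)
    (lam gam : Bool → Fin z → F)
    (hlam : Function.Injective fun p : Bool × Fin z => lam p.1 p.2)
    (hgam : ∀ i, gam false i ≠ gam true i) :
    let M : Matrix (Fin (2 ^ z) × Fin z) (Fin (2 ^ z) × Fin z) F := fun row col =>
      let cbit := ((col.1 : ℕ)).testBit (col.2 : ℕ)
      let a0 : ℕ := (col.1 : ℕ) - (if cbit then 2 ^ (col.2 : ℕ) else 0)
      if (row.1 : ℕ) = a0 then lam cbit col.2 ^ (row.2 : ℕ)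
      else if (row.1 : ℕ) = a0 + 2 ^ (col.2 : ℕ) then
        gam cbit col.2 * lam cbit col.2 ^ (row.2 : ℕ)
      else 0
    ∃ c : F, (c = 1 ∨ c = -1) ∧
      M.det = c * (∏ i : Fin z, ∏ j : Fin z,
          if (i : ℕ) < (j : ℕ) then
            ((lam false i - lam false j) * (lam true i - lam false j) *
              (lam false i - lam true j) * (lam true i - lam true j)) ^ (2 ^ (z - 2))
          else 1) *
        ∏ i : Fin z, (gam false i - gam true i) ^ (2 ^ (z - 1)) ∧
      IsUnit M.det := by
  intro M
  let A : Fin z → Matrix Bool Bool F := fun i => of fun a c => if a then gam c i else 1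
  have hA (i : Fin z) : (A i).det = -1 * (gam false i - gam true i) := by
    rw [← det_submatrix_equiv_self finTwoEquiv, det_fin_two]
    simp [A, finTwoEquiv]
  have hM : M = (of fun (r c : (Fin z → Bool) × Fin z) =>
      piKronecker (Function.update (fun _ => 1) c.2 (A c.2)) r.1 c.1 *
        lam (c.1 c.2) c.2 ^ (r.2 : ℕ)).submatrix
        ((Fin.testBitEquiv z).prodCongr (Equiv.refl _))
        ((Fin.testBitEquiv z).prodCongr (Equiv.refl _)) := by
    ext ⟨a, t⟩ ⟨x, i⟩
    simp only [M, Fin.val_eq_clearBit_iff, Fin.val_eq_setBit_iff, submatrix_apply, of_apply,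
      Equiv.prodCongr_apply, Prod.map_apply, Equiv.refl_apply, piKronecker_update_one_apply, A]
    simp only [← Fin.testBitEquiv_apply]
    by_cases h : ∀ j, j ≠ i → Fin.testBitEquiv z a j = Fin.testBitEquiv z x j
    · simp only [eq_true h, and_true, if_true]
      cases hb : Fin.testBitEquiv z a i <;> simp
    · simp only [eq_false h, and_false, if_false, zero_mul]
  have hdet : M.det = (∏ _i : Fin z, (-1) ^ (2 ^ (z - 1))) * (∏ i : Fin z, ∏ j : Fin z,
          if (i : ℕ) < (j : ℕ) then
            ((lam false i - lam false j) * (lam true i - lam false j) *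
              (lam false i - lam true j) * (lam true i - lam true j)) ^ (2 ^ (z - 2))
          else 1) *
        ∏ i : Fin z, (gam false i - gam true i) ^ (2 ^ (z - 1)) := by
    rw [hM, det_submatrix_equiv_self, det_sitewise_vandermonde A (fun i => by
      simpa [hA, sub_eq_zero] using (hgam i).symm), prod_det_vandermonde_bool]
    simp only [hA, mul_pow, Finset.prod_mul_distrib, Fintype.card_bool]
    ring
  refine ⟨_, ?_, hdet, ?_⟩
  · rw [Finset.prod_const, ← pow_mul]
    exact neg_one_pow_eq_or F _
  · have hne (b c : Bool) {i j : Fin z} (hij : (i : ℕ) < j) : lam b i - lam c j ≠ 0 := by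
      refine sub_ne_zero.mpr fun h => ?_
      have := congrArg Prod.snd (@hlam (b, i) (c, j) h)
      exact hij.ne (congrArg Fin.val this)
    rw [hdet, isUnit_iff_ne_zero]
    refine mul_ne_zero (mul_ne_zero ?_ ?_) ?_
    · simp
    · refine Finset.prod_ne_zero_iff.mpr fun i _ => Finset.prod_ne_zero_iff.mpr fun j _ => ?_
      split_ifs with hij
      · simp [hne _ _ hij]
      · exact one_ne_zero
    · exact Finset.prod_ne_zero_iff.mpr fun i _ => pow_ne_zero _ (sub_ne_zero.mpr (hgam i))
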